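/- Let (xₙ) and (yₙ) be sequences of real numbers with xₙ, yₙ ∈ [−2, 2] for all n. Suppose that for every pair (k, l) of natural numbers with either (k ≤ 4 and l ≤ 4) or (min(k,l) = 0 and max(k,l) ≤ 8), the averages (1/N)·∑_{n<N} xₙᵏ yₙˡ converge as N → ∞ to C_{k/2}·C_{l/2} if k and l are both even, and to 0 if k or l is odd. Then the set {n : xₙ·yₙ < −1.57} has positive upper density, and the set {n : xₙ·yₙ > 1.57} has positive upper density. -/

import Mathlib

open Filter
open scoped Classical

/-- The upper density of a set of natural numbers:
`limsup_{N→∞} #(S ∩ {0, …, N−1}) / N`. -/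
noncomputable def upperDensity (S : Set ℕ) : ℝ :=
  limsup (fun N : ℕ =>
    (((Finset.range N).filter (fun n => n ∈ S)).card : ℝ) / N) atTop

noncomputable def certQ (x y : ℝ) : ℝ :=
  (7424) * (x ^ 0 * y ^ 0)
    + (-103264/25) * (x ^ 1 * y ^ 1)
    + (301708) * (x ^ 2 * y ^ 2)
    + (5751099/50) * (x ^ 3 * y ^ 3)
    + (6319) * (x ^ 4 * y ^ 4)
    + (-621968/25) * (x ^ 2 * y ^ 0)
    + (-621968/25) * (x ^ 0 * y ^ 2)
    + (-1831342/25) * (x ^ 3 * y ^ 1)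
    + (-1831342/25) * (x ^ 1 * y ^ 3)
    + (-2407424/25) * (x ^ 4 * y ^ 2)
    + (-2407424/25) * (x ^ 2 * y ^ 4)
    + (937392/25) * (x ^ 4 * y ^ 0)
    + (937392/25) * (x ^ 0 * y ^ 4)
    + (-1448627/100) * (x ^ 6 * y ^ 0)
    + (-1448627/100) * (x ^ 0 * y ^ 6)
    + (3389) * (x ^ 8 * y ^ 0)
    + (3389) * (x ^ 0 * y ^ 8)

theorem certQ_nonneg (x y : ℝ) (h : -(157/100) ≤ x * y) : 0 ≤ certQ x y := by
  have e : certQ x y = ((7424) * ((1) * (1) + (-7/4) * ((x^2+y^2)) + (-15/116) * ((x*y)) + (153/232) * ((x^2+y^2)^2) + (-43/232) * ((x^2+y^2)*(x*y)) + (-663/464) * ((x*y)^2))^2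
    + (8384) * ((1) * ((x^2+y^2)) + (-700/131) * ((x*y)) + (-59/1048) * ((x^2+y^2)^2) + (4337/3200) * ((x^2+y^2)*(x*y)) + (-212/131) * ((x*y)^2))^2
    + (99649856/3799) * ((1) * ((x*y)) + (-1699135/24912464) * ((x^2+y^2)^2) + (-11336085/49824928) * ((x^2+y^2)*(x*y)) + (6038279/12456232) * ((x*y)^2))^2
    + (72123089/6228116) * ((1) * ((x^2+y^2)^2) + (-2729324443/7212308900) * ((x^2+y^2)*(x*y)) + (-285264542/72123089) * ((x*y)^2))^2
    + (7290232971861/2307938848000) * ((1) * ((x^2+y^2)*(x*y)) + (-9413019430880/7290232971861) * ((x*y)^2))^2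
    + (644435306643706/36451164859305) * ((1) * ((x*y)^2))^2)
    + (x*y + 157/100) * (x-y)^2 * ((704) * ((1) * (1) + (-17/11) * ((x^2+y^2)) + (653/176) * ((x*y)))^2 + (6683/11) * ((1) * ((x^2+y^2)) + (-19979/6683) * ((x*y)))^2 + (1927175/26732) * ((1) * ((x*y)))^2) := by
    unfold certQ; ring
  rw [e]
  have h' : 0 ≤ x*y + 157/100 := by linarith
  positivity

theorem catalan_four' : catalan 4 = 14 := by
  rw [catalan_eq_centralBinom_div]; decide

def Moments (x y : ℕ → ℝ) : Prop :=
  ∀ k l : ℕ, ((k ≤ 4 ∧ l ≤ 4) ∨ (min k l = 0 ∧ max k l ≤ 8)) →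
      Tendsto (fun N : ℕ => (∑ n ∈ Finset.range N, x n ^ k * y n ^ l) / (N : ℝ)) atTop
        (nhds (if k % 2 = 0 ∧ l % 2 = 0 then (catalan (k / 2) : ℝ) * catalan (l / 2) else 0))

theorem certQ_avg (x y : ℕ → ℝ) (hm : Moments x y) :
    Tendsto (fun N : ℕ => (∑ n ∈ Finset.range N, certQ (x n) (y n)) / (N : ℝ)) atTop
      (nhds (-26263/50)) := by
  have H := (((((((((((((((((hm 0 0 (by norm_num)).const_mul (7424)).add
      ((hm 1 1 (by norm_num)).const_mul (-103264/25))).add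
      ((hm 2 2 (by norm_num)).const_mul (301708))).add
      ((hm 3 3 (by norm_num)).const_mul (5751099/50))).add
      ((hm 4 4 (by norm_num)).const_mul (6319))).add
      ((hm 2 0 (by norm_num)).const_mul (-621968/25))).add
      ((hm 0 2 (by norm_num)).const_mul (-621968/25))).add
      ((hm 3 1 (by norm_num)).const_mul (-1831342/25))).add
      ((hm 1 3 (by norm_num)).const_mul (-1831342/25))).add
      ((hm 4 2 (by norm_num)).const_mul (-2407424/25))).add
      ((hm 2 4 (by norm_num)).const_mul (-2407424/25))).add
      ((hm 4 0 (by norm_num)).const_mul (937392/25))).add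
      ((hm 0 4 (by norm_num)).const_mul (937392/25))).add
      ((hm 6 0 (by norm_num)).const_mul (-1448627/100))).add
      ((hm 0 6 (by norm_num)).const_mul (-1448627/100))).add
      ((hm 8 0 (by norm_num)).const_mul (3389))).add
      ((hm 0 8 (by norm_num)).const_mul (3389))
  convert H using 1
  · funext N
    simp only [certQ, Finset.sum_add_distrib, ← Finset.mul_sum]
    ring
  · norm_num [catalan_zero, catalan_one, catalan_two, catalan_three, catalan_four']

theorem half_case (x y : ℕ → ℝ)
    (hx : ∀ n, x n ∈ Set.Icc (-2 : ℝ) 2) (hy : ∀ n, y n ∈ Set.Icc (-2 : ℝ) 2)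
    (hm : Moments x y) : 0 < upperDensity {n | x n * y n < -1.57} := by
  obtain ⟨M, hM0, hM⟩ : ∃ M : ℝ, 0 < M ∧ ∀ n, -M ≤ certQ (x n) (y n) := by
    have hc : IsCompact (Set.Icc (-2 : ℝ) 2 ×ˢ Set.Icc (-2 : ℝ) 2) := isCompact_Icc.prod isCompact_Icc
    have hcont : Continuous (fun p : ℝ × ℝ => certQ p.1 p.2) := by
      unfold certQ; fun_prop
    obtain ⟨b, hb⟩ := hc.bddBelow_image hcont.continuousOn
    refine ⟨|b| + 1, by positivity, fun n => ?_⟩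
    have := hb ⟨(x n, y n), ⟨hx n, hy n⟩, rfl⟩
    have h2 := neg_abs_le b
    simp only at this
    linarith
  set c : ℝ := -(-26263/50) with hc
  have hcpos : 0 < c := by rw [hc]; norm_num
  set S : Set ℕ := {n | x n * y n < -1.57} with hS
  have key : ∀ N : ℕ, -M * ((Finset.range N).filter (fun n => n ∈ S)).card
      ≤ ∑ n ∈ Finset.range N, certQ (x n) (y n) := by
    intro N
    rw [Finset.card_filter]
    push_cast
    rw [Finset.mul_sum]
    refine Finset.sum_le_sum fun n _ => ?_
    by_cases hn : n ∈ S
    · simpa [hn] using hM n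
    · have : 0 ≤ certQ (x n) (y n) := by
        apply certQ_nonneg
        simp only [hS, Set.mem_setOf_eq, not_lt] at hn
        norm_num at hn ⊢
        linarith
      simpa [hn] using this
  have hev : ∀ᶠ N : ℕ in atTop, c / (2 * M) ≤
      (((Finset.range N).filter (fun n => n ∈ S)).card : ℝ) / N := by
    have h1 := (certQ_avg x y hm).eventually_lt_const (show (-26263/50) < -(c/2) by rw [hc]; norm_num)
    filter_upwards [h1, eventually_gt_atTop 0] with N hN hN0
    have hNpos : (0 : ℝ) < N := by exact_mod_cast hN0
    rw [div_lt_iff₀ hNpos] at hN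
    have hk := key N
    rw [div_le_div_iff₀ (by positivity) hNpos]
    nlinarith
  have hpos : 0 < c / (2 * M) := by positivity
  refine hpos.trans_le ?_
  unfold upperDensity
  refine le_limsup_of_frequently_le hev.frequently ?_
  refine isBoundedUnder_of ⟨1, fun N => ?_⟩
  apply div_le_one_of_le₀ _ (by positivity)
  exact_mod_cast (Finset.card_filter_le _ _).trans_eq (Finset.card_range N)

theorem trace_asymptotics_BC2_a2
    (x y : ℕ → ℝ)
    (hx : ∀ n, x n ∈ Set.Icc (-2 : ℝ) 2) (hy : ∀ n, y n ∈ Set.Icc (-2 : ℝ) 2)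
    (hmom : ∀ k l : ℕ, ((k ≤ 4 ∧ l ≤ 4) ∨ (min k l = 0 ∧ max k l ≤ 8)) →
      Tendsto (fun N => (∑ n ∈ Finset.range N, x n ^ k * y n ^ l) / N) atTop
        (nhds (if k % 2 = 0 ∧ l % 2 = 0 then (catalan (k / 2) : ℝ) * catalan (l / 2) else 0))) :
    0 < upperDensity {n | x n * y n < -1.57} ∧
    0 < upperDensity {n | x n * y n > 1.57} := by
  refine ⟨half_case x y hx hy hmom, ?_⟩
  have h := half_case (fun n => - x n) y
    (fun n => by have := hx n; simp only [Set.mem_Icc] at this ⊢; constructor <;> linarith) hy ?_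
  · have e : {n | x n * y n > 1.57} = {n | (fun n => - x n) n * y n < -1.57} := by
      ext n
      simp only [Set.mem_setOf_eq]
      constructor <;> intro h <;> linarith
    rw [e]; exact h
  · intro k l hkl
    have h := (hmom k l hkl).const_mul ((-1 : ℝ) ^ k)
    convert h using 1
    · funext N
      rw [← mul_div_assoc, Finset.mul_sum]
      congr 1
      refine Finset.sum_congr rfl fun n _ => ?_
      rw [neg_pow (x n) k]; ring
    · congr 1
      split_ifs with hh
      · rw [(Nat.even_iff.mpr hh.1).neg_one_pow, one_mul]
      · simp
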